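/- Let a > 0 and let q be holomorphic on the strip S_a = {τ ∈ ℂ : 0 < Im τ < a} satisfying a slow-growth condition with some constants (C', N', M'). Let (g_n) be holomorphic on S_a, all satisfying a slow-growth condition with the same constants (C, N, M), and suppose g_n converges pointwise on S_a to g. Then for every Schwartz function f : ℝ → ℂ, the limits lim_{y→0+} ∫_ℝ q(x+iy) g_n(x+iy) f(x) dx and lim_{y→0+} ∫_ℝ q(x+iy) g(x+iy) f(x) dx all exist and are finite, and lim_{n→∞} [lim_{y→0+} ∫_ℝ q(x+iy) g_n(x+iy) f(x) dx] = lim_{y→0+} ∫_ℝ q(x+iy) g(x+iy) f(x) dx. -/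

import Mathlib

open MeasureTheory Filter Complex

/-- A pole-type bound on the derivative improves by half an order after integration. -/
lemma norm_le_div_sqrt_pow_of_norm_deriv_le {φ φ' : ℝ → ℂ} {b A B : ℝ} {k : ℕ}
    (hB : 0 ≤ B)
    (hd : ∀ y ∈ Set.Ioc 0 b, HasDerivAt φ (φ' y) y)
    (hφ' : ∀ y ∈ Set.Ioc 0 b, ‖φ' y‖ ≤ B / √y ^ (k + 1))
    (hφb : ‖φ b‖ ≤ A) {y : ℝ} (hy : y ∈ Set.Ioc 0 b) :
    ‖φ y‖ ≤ (A * √b ^ k + 2 * B * √b) / √y ^ k := by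
  obtain ⟨hy0, hyb⟩ := hy
  have hsy : 0 < √y := Real.sqrt_pos.2 hy0
  have hyb' : √y ≤ √b := Real.sqrt_le_sqrt hyb
  have key : ‖φ b - φ y‖ ≤ B / √y ^ k * (2 * (√b - √y)) := by
    refine image_norm_le_of_norm_deriv_right_le_deriv_boundary' (a := y) (b := b)
      (f := fun s => φ s - φ y) (f' := φ') (B := fun s => B / √y ^ k * (2 * (√s - √y)))
      (B' := fun s => B / √y ^ k * (2 * (1 / (2 * √s)))) ?_ ?_ (by simp) (by fun_prop) ?_ ?_
      (Set.right_mem_Icc.2 hyb)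
    · intro s hs
      exact ((hd s ⟨hy0.trans_le hs.1, hs.2⟩).continuousAt.sub
        continuousAt_const).continuousWithinAt
    · intro s hs
      exact ((hd s ⟨hy0.trans_le hs.1, hs.2.le⟩).sub_const _).hasDerivWithinAt
    · intro s hs
      exact ((((Real.hasDerivAt_sqrt (hy0.trans_le hs.1).ne').sub_const _).const_mul
        2).const_mul _).hasDerivWithinAt
    · intro s hs
      have hs0 : 0 < s := hy0.trans_le hs.1
      have hss : 0 < √s := Real.sqrt_pos.2 hs0
      refine (hφ' s ⟨hs0, hs.2.le⟩).trans ?_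
      have : B / √y ^ k * (2 * (1 / (2 * √s))) = B / (√y ^ k * √s) := by
        field_simp
      rw [this, pow_succ]
      have := Real.sqrt_le_sqrt hs.1
      gcongr
  have hle : ‖φ y‖ ≤ A + B / √y ^ k * (2 * √b) := by
    have h1 : ‖φ y‖ ≤ ‖φ b‖ + ‖φ b - φ y‖ := by
      simpa using norm_sub_le (φ b) (φ b - φ y)
    have h2 : B / √y ^ k * (2 * (√b - √y)) ≤ B / √y ^ k * (2 * √b) := by
      gcongr
      linarith
    linarith
  refine hle.trans ?_
  rw [le_div_iff₀ (by positivity)]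
  have hA : 0 ≤ A := (norm_nonneg _).trans hφb
  have h3 : (A + B / √y ^ k * (2 * √b)) * √y ^ k = A * √y ^ k + 2 * B * √b := by
    field_simp
  rw [h3]
  gcongr

/-- A family whose derivative in `y` is the same family at another parameter, with a uniform
polynomial bound in `1 / y`, is uniformly bounded near `y = 0`. -/
lemma exists_uniform_norm_le_of_hasDerivAt {ι S : Type*} (Φ : ι → S → ℝ → ℂ) (D : S → S) {b : ℝ}
    (hb : 0 < b) {c : ℂ} (hc : ‖c‖ = 1)
    (hd : ∀ i f, ∀ y ∈ Set.Ioc 0 b, HasDerivAt (Φ i f) (c * Φ i (D f) y) y) (k : ℕ)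
    (hΦ : ∀ f, ∃ B, 0 ≤ B ∧ ∀ i, ∀ y ∈ Set.Ioc 0 b, ‖Φ i f y‖ ≤ B / √y ^ k) (f : S) :
    ∃ B, 0 ≤ B ∧ ∀ i, ∀ y ∈ Set.Ioc 0 b, ‖Φ i f y‖ ≤ B := by
  induction k generalizing f with
  | zero => simpa using hΦ f
  | succ k ih =>
    refine ih (fun f => ?_) f
    obtain ⟨A, hA, hAf⟩ := hΦ f
    obtain ⟨B, hB, hBf⟩ := hΦ (D f)
    refine ⟨A / √b ^ (k + 1) * √b ^ k + 2 * B * √b, by positivity, fun i y hy => ?_⟩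
    refine norm_le_div_sqrt_pow_of_norm_deriv_le hB (hd i f) (fun s hs => ?_)
      (hAf i b ⟨hb, le_rfl⟩) hy
    simpa [hc] using hBf i s hs

/-- A Lipschitz function on `(0, b]` has a limit at `0`, approached at a linear rate. -/
lemma exists_tendsto_nhdsGT_zero_of_lipschitz {φ : ℝ → ℂ} {b K : ℝ} (hb : 0 < b)
    (h : ∀ s ∈ Set.Ioc 0 b, ∀ t ∈ Set.Ioc 0 b, ‖φ t - φ s‖ ≤ K * ‖t - s‖) :
    ∃ ℓ, Tendsto φ (nhdsWithin 0 (Set.Ioi 0)) (nhds ℓ) ∧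
      ∀ y ∈ Set.Ioc 0 b, ‖φ y - ℓ‖ ≤ K * y := by
  have hmem : Set.Ioc 0 b ∈ nhdsWithin (0 : ℝ) (Set.Ioi 0) := Ioc_mem_nhdsGT hb
  have hlip : LipschitzOnWith K.toNNReal φ (Set.Ioc 0 b) :=
    LipschitzOnWith.of_dist_le_mul fun s hs t ht => by
      rw [dist_eq_norm, dist_eq_norm]
      refine (h t ht s hs).trans ?_
      gcongr
      exact Real.le_coe_toNNReal K
  have hcauchy : Cauchy (Filter.map φ (nhdsWithin 0 (Set.Ioi 0))) :=
    (cauchy_nhds.mono nhdsWithin_le_nhds).map_of_le hlip.uniformContinuousOn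
      (le_principal_iff.2 hmem)
  obtain ⟨ℓ, hℓ⟩ := cauchy_map_iff_exists_tendsto.1 hcauchy
  refine ⟨ℓ, hℓ, fun y hy => ?_⟩
  have hid : Tendsto (fun s : ℝ => s) (nhdsWithin 0 (Set.Ioi 0)) (nhds 0) :=
    nhdsWithin_le_nhds
  have hr := ((hid.const_sub y).norm).const_mul K
  rw [sub_zero, Real.norm_of_nonneg hy.1.le] at hr
  refine le_of_tendsto_of_tendsto ((hℓ.const_sub (φ y)).norm) hr ?_
  filter_upwards [hmem] with s hs using h s hs y hy

/-- The integral of `h (x + i y) f x` over the horizontal line at height `y`. -/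
noncomputable def horizontalPairing (h : ℂ → ℂ) (f : SchwartzMap ℝ ℂ) (y : ℝ) : ℂ :=
  ∫ x : ℝ, h (↑x + ↑y * I) * f x

lemma integrable_one_add_abs_pow_mul_norm (f : SchwartzMap ℝ ℂ) (N : ℕ) :
    Integrable fun x : ℝ => (1 + |x|) ^ N * ‖f x‖ := by
  have h0 : Integrable fun x : ℝ => ‖f x‖ := f.integrable.norm
  have hN := f.integrable_pow_mul volume N
  refine ((h0.add hN).const_mul (2 ^ (N - 1))).mono' (by fun_prop) (ae_of_all _ fun x => ?_)
  rw [Real.norm_of_nonneg (by positivity)]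
  have := add_pow_le zero_le_one (abs_nonneg x) N
  calc (1 + |x|) ^ N * ‖f x‖ ≤ 2 ^ (N - 1) * (1 ^ N + |x| ^ N) * ‖f x‖ := by gcongr
    _ = _ := by simp; ring

section Strip

variable {a : ℝ} {h : ℂ → ℂ}

lemma isOpen_strip (a : ℝ) : IsOpen {τ : ℂ | 0 < τ.im ∧ τ.im < a} :=
  (isOpen_lt continuous_const continuous_im).inter (isOpen_lt continuous_im continuous_const)

lemma continuous_horizontal (hh : ContinuousOn h {τ : ℂ | 0 < τ.im ∧ τ.im < a})
    {y : ℝ} (hy : y ∈ Set.Ioo 0 a) : Continuous fun x : ℝ => h (↑x + ↑y * I) :=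
  hh.comp_continuous (by fun_prop) fun x => by simpa using hy

variable {K : ℝ} {N M : ℕ}

lemma integrable_horizontal_mul (hh : ContinuousOn h {τ : ℂ | 0 < τ.im ∧ τ.im < a})
    (hbd : ∀ x y : ℝ, 0 < y → y < a → ‖h (↑x + ↑y * I)‖ ≤ K * (1 + |x|) ^ N / y ^ M)
    (f : SchwartzMap ℝ ℂ) {y : ℝ} (hy : y ∈ Set.Ioo 0 a) :
    Integrable fun x : ℝ => h (↑x + ↑y * I) * f x := by
  refine ((integrable_one_add_abs_pow_mul_norm f N).const_mul (K / y ^ M)).mono'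
    ((continuous_horizontal hh hy).mul f.continuous).aestronglyMeasurable
    (ae_of_all _ fun x => ?_)
  rw [norm_mul]
  calc _ ≤ K * (1 + |x|) ^ N / y ^ M * ‖f x‖ := by gcongr; exact hbd x y hy.1 hy.2
    _ = _ := by ring

lemma norm_horizontalPairing_le
    (hbd : ∀ x y : ℝ, 0 < y → y < a → ‖h (↑x + ↑y * I)‖ ≤ K * (1 + |x|) ^ N / y ^ M)
    (f : SchwartzMap ℝ ℂ) {y : ℝ} (hy : y ∈ Set.Ioo 0 a) :
    ‖horizontalPairing h f y‖ ≤ K * (∫ x : ℝ, (1 + |x|) ^ N * ‖f x‖) / y ^ M := by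
  have := norm_integral_le_of_norm_le (f := fun x : ℝ => h (↑x + ↑y * I) * f x)
    ((integrable_one_add_abs_pow_mul_norm f N).const_mul (K / y ^ M))
    (ae_of_all _ fun x => by
      rw [norm_mul]
      calc _ ≤ K * (1 + |x|) ^ N / y ^ M * ‖f x‖ := by gcongr; exact hbd x y hy.1 hy.2
        _ = _ := by ring)
  rw [integral_const_mul] at this
  exact this.trans_eq (by ring)

/-- Cauchy's estimate on a horizontal line, locally uniform in the height. -/
lemma exists_norm_deriv_horizontal_le (hK : 0 ≤ K)
    (hh : DifferentiableOn ℂ h {τ : ℂ | 0 < τ.im ∧ τ.im < a})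
    (hbd : ∀ x y : ℝ, 0 < y → y < a → ‖h (↑x + ↑y * I)‖ ≤ K * (1 + |x|) ^ N / y ^ M)
    {y₀ : ℝ} (hy₀ : y₀ ∈ Set.Ioo 0 a) :
    ∃ r L, 0 < r ∧ Metric.ball y₀ r ⊆ Set.Ioo 0 a ∧ ∀ y ∈ Metric.ball y₀ r, ∀ x : ℝ,
      ‖deriv h (↑x + ↑y * I)‖ ≤ L * (1 + |x|) ^ N := by
  obtain ⟨h0, h1⟩ := hy₀
  obtain ⟨r, hr, hr1, hr2, hr3⟩ : ∃ r : ℝ, 0 < r ∧ r ≤ 1 ∧ 4 * r ≤ y₀ ∧ 4 * r ≤ a - y₀ :=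
    ⟨min 1 (min (y₀ / 4) ((a - y₀) / 4)), by
      refine lt_min one_pos (lt_min ?_ ?_) <;> linarith, min_le_left _ _, by
      have := (min_le_right 1 _).trans (min_le_left (y₀ / 4) ((a - y₀) / 4)); linarith, by
      have := (min_le_right 1 _).trans (min_le_right (y₀ / 4) ((a - y₀) / 4)); linarith⟩
  refine ⟨r, K * 2 ^ N / r ^ M / r, hr, fun y hy => ?_, fun y hy x => ?_⟩
  · rw [Metric.mem_ball, Real.dist_eq, abs_lt] at hy
    constructor <;> linarith [hy.1, hy.2]
  · rw [Metric.mem_ball, Real.dist_eq, abs_lt] at hy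
    have hcoord : ∀ z ∈ Metric.closedBall ((x : ℂ) + y * I) r,
        |z.re| ≤ 1 + |x| ∧ r ≤ z.im ∧ z.im < a := by
      intro z hz
      rw [Metric.mem_closedBall, dist_eq_norm] at hz
      have hre := (abs_re_le_norm _).trans hz
      have him := (abs_im_le_norm _).trans hz
      simp only [sub_re, add_re, ofReal_re, mul_re, I_re, mul_zero, ofReal_im, I_im, mul_one,
        sub_self, add_zero] at hre
      simp only [sub_im, add_im, ofReal_im, mul_im, ofReal_re, I_im, mul_one, I_re, mul_zero,
        add_zero, zero_add] at him
      rw [abs_le] at him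
      refine ⟨?_, by linarith [him.1, hy.1], by linarith [him.2, hy.2]⟩
      have := abs_sub_abs_le_abs_sub z.re x
      linarith
    have hle := norm_deriv_le_of_forall_mem_sphere_norm_le (f := h)
      (c := (x : ℂ) + y * I) (C := K * (2 * (1 + |x|)) ^ N / r ^ M) hr
      (DifferentiableOn.diffContOnCl_ball (hh.mono fun z hz => ?_) subset_rfl) (fun z hz => ?_)
    · exact hle.trans_eq (by rw [mul_pow]; ring)
    · obtain ⟨-, h2, h3⟩ := hcoord z hz
      exact ⟨hr.trans_le h2, h3⟩
    · obtain ⟨h1, h2, h3⟩ := hcoord z (Metric.sphere_subset_closedBall hz)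
      have := hbd z.re z.im (hr.trans_le h2) h3
      rw [re_add_im] at this
      refine this.trans ?_
      gcongr
      linarith [abs_nonneg x]

/-- Differentiating in the height amounts to differentiating the test function. -/
lemma hasDerivAt_horizontalPairing (hK : 0 ≤ K)
    (hh : DifferentiableOn ℂ h {τ : ℂ | 0 < τ.im ∧ τ.im < a})
    (hbd : ∀ x y : ℝ, 0 < y → y < a → ‖h (↑x + ↑y * I)‖ ≤ K * (1 + |x|) ^ N / y ^ M)
    (f : SchwartzMap ℝ ℂ) {y : ℝ} (hy : y ∈ Set.Ioo 0 a) :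
    HasDerivAt (horizontalPairing h f)
      (-I * horizontalPairing h (SchwartzMap.derivCLM ℂ ℂ f) y) y := by
  obtain ⟨r, L, hr, hsub, hL⟩ := exists_norm_deriv_horizontal_le hK hh hbd hy
  have hat : ∀ x : ℝ, ∀ s ∈ Set.Ioo 0 a,
      HasDerivAt h (deriv h (↑x + ↑s * I)) (↑x + ↑s * I) := fun x s hs =>
    (hh.differentiableAt ((isOpen_strip a).mem_nhds (by simpa using hs))).hasDerivAt
  have hdc : Continuous fun x : ℝ => deriv h (↑x + ↑y * I) :=
    continuous_horizontal (hh.deriv (isOpen_strip a)).continuousOn hy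
  have hwint := (integrable_one_add_abs_pow_mul_norm f N).const_mul L
  have hder := hasDerivAt_integral_of_dominated_loc_of_deriv_le (μ := volume) (x₀ := y)
    (F := fun (s : ℝ) (x : ℝ) => h (↑x + ↑s * I) * f x)
    (F' := fun (s : ℝ) (x : ℝ) => deriv h (↑x + ↑s * I) * I * f x)
    (bound := fun x => L * ((1 + |x|) ^ N * ‖f x‖))
    (Metric.ball_mem_nhds y hr)
    (by
      filter_upwards [isOpen_Ioo.mem_nhds hy] with s hs
      exact ((continuous_horizontal hh.continuousOn hs).mul f.continuous).aestronglyMeasurable)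
    (integrable_horizontal_mul hh.continuousOn hbd f hy)
    ((hdc.mul continuous_const).mul f.continuous).aestronglyMeasurable
    (ae_of_all _ fun x s hs => by
      rw [norm_mul, norm_mul, norm_I, mul_one, ← mul_assoc]
      gcongr
      exact hL s hs x)
    hwint
    (ae_of_all _ fun x s hs => by
      have hin : HasDerivAt (fun s : ℝ => (x : ℂ) + s * I) I s := by
        simpa using ((hasDerivAt_id s).ofReal_comp.mul_const I).const_add (x : ℂ)
      exact ((hat x s (hsub hs)).comp s hin).mul_const _)
  have hparts : ∫ x : ℝ, h (↑x + ↑y * I) * deriv f x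
      = -∫ x : ℝ, deriv h (↑x + ↑y * I) * f x := by
    refine integral_mul_deriv_eq_deriv_mul_of_integrable (u := fun x : ℝ => h (↑x + ↑y * I))
      (v := f) (u' := fun x : ℝ => deriv h (↑x + ↑y * I)) (v' := deriv f) (fun x _ => ?_)
      (fun x _ => f.hasDerivAt x)
      (integrable_horizontal_mul hh.continuousOn hbd (SchwartzMap.derivCLM ℂ ℂ f) hy) ?_
      (integrable_horizontal_mul hh.continuousOn hbd f hy)
    · have hin : HasDerivAt (fun x : ℝ => (x : ℂ) + y * I) 1 x := by
        simpa using (hasDerivAt_id x).ofReal_comp.add_const ((y : ℂ) * I)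
      simpa [Function.comp_def] using (hat x y hy).comp x hin
    · refine hwint.mono' (hdc.mul f.continuous).aestronglyMeasurable (ae_of_all _ fun x => ?_)
      rw [Pi.mul_apply, norm_mul, ← mul_assoc]
      gcongr
      exact hL y (Metric.mem_ball_self hr) x
  refine hder.2.congr_deriv ?_
  simp only [horizontalPairing, SchwartzMap.derivCLM_apply]
  rw [hparts, neg_mul_neg, ← integral_const_mul]
  congr 1 with x
  ring

end Strip

lemma one_add_pow_le_two_mul_one_add_pow {t : ℝ} (ht : 0 ≤ t) (N : ℕ) :
    1 + t ^ N ≤ 2 * (1 + t) ^ N := by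
  have h1 : 1 ≤ (1 + t) ^ N := one_le_pow₀ (by linarith)
  have h2 : t ^ N ≤ (1 + t) ^ N := by gcongr; linarith
  linarith

/-- Boundary values of a pointwise convergent sequence of holomorphic functions of uniformly slow
growth converge. -/
lemma boundary_values_converge {a K : ℝ} {N M : ℕ} (ha : 0 < a) (hK : 0 ≤ K)
    (hseq : ℕ → ℂ → ℂ) (h : ℂ → ℂ)
    (hh : ∀ n, DifferentiableOn ℂ (hseq n) {τ : ℂ | 0 < τ.im ∧ τ.im < a})
    (hbd : ∀ n, ∀ x y : ℝ, 0 < y → y < a →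
      ‖hseq n (↑x + ↑y * I)‖ ≤ K * (1 + |x|) ^ N / y ^ M)
    (hlim : ∀ τ : ℂ, 0 < τ.im → τ.im < a →
      Tendsto (fun n => hseq n τ) atTop (nhds (h τ))) (f : SchwartzMap ℝ ℂ) :
    ∃ (ℓ : ℕ → ℂ) (Lim : ℂ),
      (∀ n, Tendsto (horizontalPairing (hseq n) f) (nhdsWithin 0 (Set.Ioi 0)) (nhds (ℓ n))) ∧
      Tendsto (horizontalPairing h f) (nhdsWithin 0 (Set.Ioi 0)) (nhds Lim) ∧
      Tendsto ℓ atTop (nhds Lim) := by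
  have hb : 0 < a / 2 := by linarith
  have hsub : Set.Ioc 0 (a / 2) ⊆ Set.Ioo 0 a := fun y hy => ⟨hy.1, by linarith [hy.2]⟩
  have hd : ∀ n f, ∀ y ∈ Set.Ioc 0 (a / 2), HasDerivAt (horizontalPairing (hseq n) f)
      (-I * horizontalPairing (hseq n) (SchwartzMap.derivCLM ℂ ℂ f) y) y := fun n f y hy =>
    hasDerivAt_horizontalPairing hK (hh n) (hbd n) f (hsub hy)
  obtain ⟨B, hB, hBf⟩ := exists_uniform_norm_le_of_hasDerivAt
    (fun n f => horizontalPairing (hseq n) f) (SchwartzMap.derivCLM ℂ ℂ) hb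
    (by simp) hd (2 * M) (fun f =>
      ⟨K * ∫ x : ℝ, (1 + |x|) ^ N * ‖f x‖,
        mul_nonneg hK (integral_nonneg fun x => by positivity), fun n y hy => by
        rw [pow_mul, Real.sq_sqrt hy.1.le]
        exact norm_horizontalPairing_le (hbd n) f (hsub hy)⟩) (SchwartzMap.derivCLM ℂ ℂ f)
  have hlip : ∀ n, ∀ s ∈ Set.Ioc 0 (a / 2), ∀ t ∈ Set.Ioc 0 (a / 2),
      ‖horizontalPairing (hseq n) f t - horizontalPairing (hseq n) f s‖ ≤ B * ‖t - s‖ :=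
    fun n s hs t ht => (convex_Ioc 0 (a / 2)).norm_image_sub_le_of_norm_hasDerivWithin_le
      (fun y hy => (hd n f y hy).hasDerivWithinAt)
      (fun y hy => by simpa using hBf n y hy) hs ht
  have hpt : ∀ y ∈ Set.Ioc 0 (a / 2), Tendsto (fun n => horizontalPairing (hseq n) f y) atTop
      (nhds (horizontalPairing h f y)) := by
    intro y hy
    have hy' := hsub hy
    refine tendsto_integral_of_dominated_convergence
      (fun x => K / y ^ M * ((1 + |x|) ^ N * ‖f x‖))
      (fun n => (integrable_horizontal_mul (hh n).continuousOn (hbd n) f hy').1)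
      ((integrable_one_add_abs_pow_mul_norm f N).const_mul _)
      (fun n => ae_of_all _ fun x => ?_) (ae_of_all _ fun x => ?_)
    · rw [norm_mul]
      calc _ ≤ K * (1 + |x|) ^ N / y ^ M * ‖f x‖ := by gcongr; exact hbd n x y hy'.1 hy'.2
        _ = _ := by ring
    · exact (hlim _ (by simpa using hy'.1) (by simpa using hy'.2)).mul_const _
  have hlip' : ∀ s ∈ Set.Ioc 0 (a / 2), ∀ t ∈ Set.Ioc 0 (a / 2),
      ‖horizontalPairing h f t - horizontalPairing h f s‖ ≤ B * ‖t - s‖ := fun s hs t ht =>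
    le_of_tendsto ((hpt t ht).sub (hpt s hs)).norm (Eventually.of_forall fun n => hlip n s hs t ht)
  choose ℓ hℓ hℓB using fun n => exists_tendsto_nhdsGT_zero_of_lipschitz hb (hlip n)
  obtain ⟨Lim, hLim, hLimB⟩ := exists_tendsto_nhdsGT_zero_of_lipschitz hb hlip'
  refine ⟨ℓ, Lim, hℓ, hLim, Metric.tendsto_atTop'.2 fun ε hε => ?_⟩
  obtain ⟨y, hy, hyε⟩ : ∃ y ∈ Set.Ioc 0 (a / 2), B * y < ε / 3 := by
    have hid : Tendsto (fun s : ℝ => B * s) (nhdsWithin 0 (Set.Ioi 0)) (nhds (B * 0)) :=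
      (continuous_const_mul B).continuousAt.mono_left nhdsWithin_le_nhds
    have hev := hid.eventually_lt_const (show B * 0 < ε / 3 by rw [mul_zero]; positivity)
    obtain ⟨y, h1, h2⟩ := ((show ∀ᶠ y in nhdsWithin (0 : ℝ) (Set.Ioi 0), y ∈ Set.Ioc 0 (a / 2) from
      Ioc_mem_nhdsGT hb).and hev).exists
    exact ⟨y, h1, h2⟩
  obtain ⟨n₀, hn₀⟩ := Metric.tendsto_atTop'.1 (hpt y hy) (ε / 3) (by positivity)
  refine ⟨n₀, fun n hn => ?_⟩
  have h1 := hn₀ n hn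
  have h2 := hℓB n y hy
  have h3 := hLimB y hy
  rw [← dist_eq_norm] at h2 h3
  rw [dist_comm] at h2
  have h4 := dist_triangle4 (ℓ n) (horizontalPairing (hseq n) f y) (horizontalPairing h f y) Lim
  linarith

/-- **Boundary values with a slow-growth holomorphic prefactor `q`.**
If `q` and the `gseq n` are holomorphic on the strip `0 < Im τ < a` with slow-growth bounds
(uniform in `n` for the `gseq n`), and `gseq n → g` pointwise, then for every Schwartz `f`
the boundary values of `q ⬝ gseq n` and `q ⬝ g` exist and
`lim_n [lim_{y→0+} ∫ q gseq n f] = lim_{y→0+} ∫ q g f`. -/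
theorem boundary_values_with_prefactor_converge
    (a : ℝ) (ha : 0 < a)
    (q : ℂ → ℂ)
    (hq : DifferentiableOn ℂ q {τ : ℂ | 0 < τ.im ∧ τ.im < a})
    (C' : ℝ) (hC' : 0 < C') (N' M' : ℕ)
    (hqbound : ∀ x y : ℝ, 0 < y → y < a →
      ‖q (↑x + ↑y * Complex.I)‖ ≤ C' * (1 + |x| ^ N') / y ^ M')
    (C : ℝ) (hC : 0 < C) (N M : ℕ)
    (gseq : ℕ → ℂ → ℂ) (g : ℂ → ℂ)
    (hgseq : ∀ n, DifferentiableOn ℂ (gseq n) {τ : ℂ | 0 < τ.im ∧ τ.im < a})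
    (hbound : ∀ n, ∀ x y : ℝ, 0 < y → y < a →
      ‖gseq n (↑x + ↑y * Complex.I)‖ ≤ C * (1 + |x| ^ N) / y ^ M)
    (hlim : ∀ τ : ℂ, 0 < τ.im → τ.im < a →
      Tendsto (fun n => gseq n τ) atTop (nhds (g τ))) :
    ∀ f : SchwartzMap ℝ ℂ,
      ∃ (ℓ : ℕ → ℂ) (Lim : ℂ),
        (∀ n, Tendsto
          (fun y : ℝ => ∫ x : ℝ,
            q (↑x + ↑y * Complex.I) * gseq n (↑x + ↑y * Complex.I) * f x)
          (nhdsWithin 0 (Set.Ioi 0)) (nhds (ℓ n))) ∧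
        Tendsto
          (fun y : ℝ => ∫ x : ℝ,
            q (↑x + ↑y * Complex.I) * g (↑x + ↑y * Complex.I) * f x)
          (nhdsWithin 0 (Set.Ioi 0)) (nhds Lim) ∧
        Tendsto ℓ atTop (nhds Lim) := by
  intro f
  refine boundary_values_converge (K := C' * 2 * (C * 2)) (N := N' + N) (M := M' + M) ha
    (by positivity) (fun n τ => q τ * gseq n τ) (fun τ => q τ * g τ)
    (fun n => hq.mul (hgseq n)) (fun n x y hy hya => ?_)
    (fun τ h0 h1 => (hlim τ h0 h1).const_mul (q τ)) f
  rw [norm_mul]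
  calc _ ≤ C' * (1 + |x| ^ N') / y ^ M' * (C * (1 + |x| ^ N) / y ^ M) := by
        gcongr
        exacts [hqbound x y hy hya, hbound n x y hy hya]
    _ ≤ C' * (2 * (1 + |x|) ^ N') / y ^ M' * (C * (2 * (1 + |x|) ^ N) / y ^ M) := by
        gcongr <;> exact one_add_pow_le_two_mul_one_add_pow (abs_nonneg x) _
    _ = _ := by rw [pow_add, pow_add]; field_simp
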